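/- Let E = ⋂_{n≥1} E_n where E_n is a union of finitely many disjoint closed intervals in [0,1], each interval of E_n has length at most δ_n with δ_n → 0, the intervals of E_n are separated by gaps of length at least ε_n (ε_n > ε_{n+1} > 0), and each interval of E_n contains at least m_{n+1} ≥ 2 intervals of E_{n+1}. Then dim_H E ≥ liminf_{n→∞} log(m_2 ⋯ m_n)/(−log(m_{n+1} ε_{n+1})). -/

import Mathlib

open Filter Set

lemma fal_children (s : Finset (ℝ × ℝ)) (k : ℕ) (hk : k ≤ s.card)
    (h1 : ∀ I ∈ s, I.1 ≤ I.2)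
    (hd : ∀ I ∈ s, ∀ J ∈ s, I ≠ J → Disjoint (Set.Icc I.1 I.2) (Set.Icc J.1 J.2)) :
    ∃ c : ℕ → ℝ × ℝ, (∀ i < k, c i ∈ s) ∧ ∀ i j, i < j → j < k → (c i).2 < (c j).1 := by
  classical
  have hinj : Set.InjOn Prod.fst (s : Set (ℝ × ℝ)) := by
    intro I hI J hJ h
    by_contra hne
    have hmemI : I.1 ∈ Set.Icc I.1 I.2 := ⟨le_rfl, h1 I hI⟩
    exact Set.disjoint_left.1 (hd I hI J hJ hne) hmemI ⟨h.symm.le, h ▸ h1 J hJ⟩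
  have hcard : (s.image Prod.fst).card = s.card := Finset.card_image_of_injOn hinj
  let e := (s.image Prod.fst).orderEmbOfFin hcard
  have hx : ∀ i : Fin s.card, ∃ I ∈ s, I.1 = e i := fun i =>
    Finset.mem_image.1 ((s.image Prod.fst).orderEmbOfFin_mem hcard i)
  choose q hq hqe using hx
  refine ⟨fun i => if h : i < s.card then q ⟨i, h⟩ else 0, ?_, ?_⟩
  · intro i hi
    have : i < s.card := by omega
    simp only [this, dif_pos]
    exact hq _
  · intro i j hij hj
    have h2 : j < s.card := by omega
    have h3 : i < s.card := by omega
    simp only [h2, h3, dif_pos]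
    have hlt : (q ⟨i, h3⟩).1 < (q ⟨j, h2⟩).1 := by
      rw [hqe, hqe]; exact e.strictMono (by simpa using hij)
    by_contra hcon
    push Not at hcon
    have hne : q ⟨i, h3⟩ ≠ q ⟨j, h2⟩ := fun h => by rw [h] at hlt; exact lt_irrefl _ hlt
    have hmemI : (q ⟨j, h2⟩).1 ∈ Set.Icc (q ⟨i, h3⟩).1 (q ⟨i, h3⟩).2 := ⟨hlt.le, hcon⟩
    exact Set.disjoint_left.1 (hd _ (hq _) _ (hq _) hne) hmemI ⟨le_rfl, h1 _ (hq _)⟩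

lemma fal_tree
    (S : ℕ → Finset (ℝ × ℝ))
    (hne : (S 1).Nonempty)
    (hsub : ∀ n ≥ 1, ∀ I ∈ S n, I.1 ≤ I.2 ∧ Set.Icc I.1 I.2 ⊆ Set.Icc (0 : ℝ) 1)
    (hdisj : ∀ n ≥ 1, ∀ I ∈ S n, ∀ J ∈ S n, I ≠ J →
      Disjoint (Set.Icc I.1 I.2) (Set.Icc J.1 J.2))
    (m : ℕ → ℕ)
    (hm2 : ∀ n ≥ 2, 2 ≤ m n)
    (hcount : ∀ n ≥ 1, ∀ J ∈ S n,
      m (n + 1) ≤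
        {I : ℝ × ℝ | I ∈ S (n + 1) ∧ Set.Icc I.1 I.2 ⊆ Set.Icc J.1 J.2}.ncard)
    (M : ℕ → ℕ) (hM0 : M 0 = 1) (hM : ∀ n, M (n + 1) = M n * m (n + 2)) :
    ∃ J : ℕ → ℕ → ℝ × ℝ, (∀ n, ∀ k < M n, J n k ∈ S (n + 1)) ∧
      (∀ n, ∀ k < M (n + 1), Set.Icc (J (n + 1) k).1 (J (n + 1) k).2 ⊆
        Set.Icc (J n (k / m (n + 2))).1 (J n (k / m (n + 2))).2) ∧
      (∀ n k k', k < k' → k' < M n → (J n k).2 < (J n k').1) := by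
  classical
  have hch : ∀ n : ℕ, ∀ I : ℝ × ℝ, ∃ c : ℕ → ℝ × ℝ, I ∈ S (n + 1) →
      (∀ i < m (n + 2), c i ∈ S (n + 2) ∧ Set.Icc (c i).1 (c i).2 ⊆ Set.Icc I.1 I.2) ∧
      ∀ i j, i < j → j < m (n + 2) → (c i).2 < (c j).1 := by
    intro n I
    by_cases hI : I ∈ S (n + 1)
    · have hc := hcount (n + 1) (by omega) I hI
      have heq : {K : ℝ × ℝ | K ∈ S (n + 1 + 1) ∧ Set.Icc K.1 K.2 ⊆ Set.Icc I.1 I.2} =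
          ((S (n + 2)).filter (fun K => Set.Icc K.1 K.2 ⊆ Set.Icc I.1 I.2) : Finset _) := by
        ext K; simp
      rw [heq, Set.ncard_coe_finset] at hc
      obtain ⟨c, hc1, hc2⟩ := fal_children _ _ hc
        (fun K hK => (hsub (n + 2) (by omega) K (Finset.mem_filter.1 hK).1).1)
        (fun K hK L hL => hdisj (n + 2) (by omega) K (Finset.mem_filter.1 hK).1 L
          (Finset.mem_filter.1 hL).1)
      exact ⟨c, fun _ => ⟨fun i hi => Finset.mem_filter.1 (hc1 i hi), hc2⟩⟩
    · exact ⟨fun _ => 0, fun h => absurd h hI⟩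
  choose c hc using hch
  obtain ⟨I0, hI0⟩ := hne
  let J : ℕ → ℕ → ℝ × ℝ := fun n => Nat.rec (fun _ => I0)
    (fun n Jn k => c n (Jn (k / m (n + 2))) (k % m (n + 2))) n
  have hJ : ∀ n k, J (n + 1) k = c n (J n (k / m (n + 2))) (k % m (n + 2)) := fun n k => rfl
  have hmpos : ∀ n, 0 < m (n + 2) := fun n => by have := hm2 (n + 2) (by omega); omega
  have hdiv : ∀ n, ∀ k < M (n + 1), k / m (n + 2) < M n := by
    intro n k hk
    rw [hM] at hk
    exact (Nat.div_lt_iff_lt_mul (hmpos n)).2 hk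
  have hmem : ∀ n, ∀ k < M n, J n k ∈ S (n + 1) := by
    intro n
    induction n with
    | zero => intro k _; exact hI0
    | succ n ih =>
      intro k hk
      rw [hJ]
      exact ((hc n _ (ih _ (hdiv n k hk))).1 _ (Nat.mod_lt _ (hmpos n))).1
  have hnest : ∀ n, ∀ k < M (n + 1), Set.Icc (J (n + 1) k).1 (J (n + 1) k).2 ⊆
        Set.Icc (J n (k / m (n + 2))).1 (J n (k / m (n + 2))).2 := by
    intro n k hk
    rw [hJ]
    exact ((hc n _ (hmem n _ (hdiv n k hk))).1 _ (Nat.mod_lt _ (hmpos n))).2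
  refine ⟨J, hmem, hnest, ?_⟩
  intro n
  induction n with
  | zero => intro k k' h1 h2; omega
  | succ n ih =>
    intro k k' h1 h2
    rcases (Nat.div_le_div_right (c := m (n + 2)) h1.le).lt_or_eq with h | h
    · have h3 := ih _ _ h (hdiv n k' h2)
      have hl : ∀ k < M (n + 1), (J (n + 1) k).1 ≤ (J (n + 1) k).2 := fun k hk =>
        (hsub (n + 2) (by omega) _ (hmem (n + 1) k hk)).1
      have h4 := hnest n k (by omega) ⟨hl k (by omega), le_rfl⟩
      have h5 := hnest n k' h2 ⟨le_rfl, hl k' h2⟩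
      exact h4.2.trans_lt (h3.trans_le h5.1)
    · rw [hJ, hJ, ← h]
      refine (hc n _ (hmem n _ (hdiv n k (by omega)))).2 _ _ ?_ (Nat.mod_lt _ (hmpos n))
      have e1 := Nat.div_add_mod k (m (n + 2))
      have e2 := Nat.div_add_mod k' (m (n + 2))
      rw [← h] at e2
      omega

lemma fal_interp (P B d q s : ℝ) (hP : 0 < P) (hq : 0 < q) (hs0 : 0 < s) (hs1 : s ≤ 1)
    (hB : 0 ≤ B) (hd : 0 < d) (h1 : d ≤ 1 / P) (h2 : d ≤ B / (q * P))
    (h3 : s * (-Real.log q) ≤ Real.log P) : d ≤ B ^ s := by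
  have hBpos : 0 < B := by
    by_contra h
    have : B = 0 := le_antisymm (not_lt.1 h) hB
    rw [this, zero_div] at h2
    linarith
  rw [← Real.log_le_log_iff hd (Real.rpow_pos_of_pos hBpos s), Real.log_rpow hBpos]
  have l1 := Real.log_le_log hd h1
  have l2 := Real.log_le_log hd h2
  rw [Real.log_div one_ne_zero hP.ne', Real.log_one] at l1
  rw [Real.log_div hBpos.ne' (by positivity), Real.log_mul hq.ne' hP.ne'] at l2
  nlinarith [mul_le_mul_of_nonneg_left l2 hs0.le, mul_le_mul_of_nonneg_left l1 (sub_nonneg.2 hs1)]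

theorem falconer_lower_bound
    (S : ℕ → Finset (ℝ × ℝ))
    (hne : (S 1).Nonempty)
    (hsub : ∀ n ≥ 1, ∀ I ∈ S n, I.1 ≤ I.2 ∧ Set.Icc I.1 I.2 ⊆ Set.Icc (0 : ℝ) 1)
    (hdisj : ∀ n ≥ 1, ∀ I ∈ S n, ∀ J ∈ S n, I ≠ J →
      Disjoint (Set.Icc I.1 I.2) (Set.Icc J.1 J.2))
    (δ : ℕ → ℝ)
    (hδlen : ∀ n ≥ 1, ∀ I ∈ S n, I.2 - I.1 ≤ δ n)
    (hδ0 : Tendsto δ atTop (nhds 0))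
    (ε : ℕ → ℝ)
    (hεpos : ∀ n ≥ 1, 0 < ε (n + 1))
    (hεanti : ∀ n ≥ 1, ε (n + 1) < ε n)
    (hgap : ∀ n ≥ 1, ∀ I ∈ S n, ∀ J ∈ S n, I ≠ J →
      ∀ x ∈ Set.Icc I.1 I.2, ∀ y ∈ Set.Icc J.1 J.2, ε n ≤ |x - y|)
    (hnest : ∀ n ≥ 1, ∀ I ∈ S (n + 1), ∃ J ∈ S n, Set.Icc I.1 I.2 ⊆ Set.Icc J.1 J.2)
    (m : ℕ → ℕ)
    (hm2 : ∀ n ≥ 2, 2 ≤ m n)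
    (hcount : ∀ n ≥ 1, ∀ J ∈ S n,
      m (n + 1) ≤
        {I : ℝ × ℝ | I ∈ S (n + 1) ∧ Set.Icc I.1 I.2 ⊆ Set.Icc J.1 J.2}.ncard)
    (E : Set ℝ)
    (hE : E = ⋂ n ∈ {n : ℕ | 1 ≤ n}, ⋃ I ∈ S n, Set.Icc I.1 I.2) :
    liminf (fun n : ℕ => ENNReal.ofReal
        (Real.log (∏ i ∈ Finset.Icc 2 n, (m i : ℝ)) /
          (-Real.log (m (n + 1) * ε (n + 1))))) atTop ≤ dimH E := by
  classical
  refine ENNReal.le_of_forall_nnreal_lt fun r hr => ?_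
  rcases eq_or_ne r 0 with rfl | hr0
  · simp
  have hrpos : 0 < (r : ℝ) := by positivity
  let M : ℕ → ℕ := fun n => ∏ i ∈ Finset.Icc 2 (n + 1), m i
  have hM0 : M 0 = 1 := by simp [M]
  have hM : ∀ n, M (n + 1) = M n * m (n + 2) := fun n =>
    Finset.prod_Icc_succ_top (by omega) _
  have hm2' : ∀ n, 2 ≤ m (n + 2) := fun n => hm2 _ (by omega)
  have hMge : ∀ n, 2 ^ n ≤ M n := by
    intro n
    induction n with
    | zero => simp [hM0]
    | succ n ih => rw [hM, pow_succ]; exact Nat.mul_le_mul ih (hm2' n)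
  have hMpos : ∀ n, 0 < M n := fun n => lt_of_lt_of_le (by positivity) (hMge n)
  have hε : ∀ n, 0 < ε (n + 1) := by
    intro n
    exact (hεpos (n + 1) (by omega)).trans (hεanti (n + 1) (by omega))
  obtain ⟨J, hJmem, hJnest, hJord⟩ := fal_tree S hne hsub hdisj m hm2 hcount M hM0 hM
  -- separation
  have hsep : ∀ n k p, k + p + 1 < M n →
      (J n k).2 + (p + 1 : ℕ) * ε (n + 1) ≤ (J n (k + p + 1)).1 := by
    intro n k p
    have step : ∀ k, k + 1 < M n → (J n k).2 + ε (n + 1) ≤ (J n (k + 1)).1 := by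
      intro k hk
      have hlt := hJord n k (k + 1) (by omega) hk
      have hk1 := hJmem n k (by omega)
      have hk2 := hJmem n (k + 1) hk
      have hl1 := (hsub (n + 1) (by omega) _ hk1).1
      have hl2 := (hsub (n + 1) (by omega) _ hk2).1
      have hne : J n k ≠ J n (k + 1) := by
        intro h
        rw [h] at hlt
        linarith
      have := hgap (n + 1) (by omega) _ hk1 _ hk2 hne _ ⟨hl1, le_rfl⟩ _ ⟨le_rfl, hl2⟩
      rw [abs_of_neg (by linarith)] at this
      linarith
    induction p with
    | zero => intro h; simpa using step k h
    | succ p ih =>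
      intro h
      have h1 := ih (by omega)
      have h2 := step (k + p + 1) (by omega)
      have hl := (hsub (n + 1) (by omega) _ (hJmem n (k + p + 1) (by omega))).1
      have e : k + (p + 1) + 1 = k + p + 1 + 1 := by omega
      rw [e]
      push_cast at h1 ⊢
      linarith
  -- counting bound
  have hbd : ∀ n, (M n : ℝ) * (m (n + 2) * ε (n + 2)) ≤ 2 := by
    intro n
    have h2 : 2 ≤ M (n + 1) := le_trans (by rw [pow_succ]; have := Nat.one_le_two_pow (n := n); omega) (hMge (n + 1))
    have h := hsep (n + 1) 0 (M (n + 1) - 2) (by omega)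
    have e : 0 + (M (n + 1) - 2) + 1 = M (n + 1) - 1 := by omega
    have e' : (M (n + 1) - 2) + 1 = M (n + 1) - 1 := by omega
    rw [e, e', Nat.cast_sub (by omega)] at h
    have a1 := hsub (n + 2) (by omega) _ (hJmem (n + 1) 0 (by omega))
    have a2 := hsub (n + 2) (by omega) _ (hJmem (n + 1) (M (n + 1) - 1) (by omega))
    have b1 := (a1.2 ⟨a1.1, le_rfl⟩).1
    have b2 := (a2.2 ⟨le_rfl, a2.1⟩).2
    have e3 : (M (n + 1) : ℝ) = M n * m (n + 2) := by rw [hM]; push_cast; ring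
    have h2' : (2 : ℝ) ≤ M (n + 1) := by exact_mod_cast h2
    have hp := hε (n + 1)
    rw [← mul_assoc, ← e3]
    push_cast at h
    have : ε (n + 1 + 1) = ε (n + 2) := rfl
    rw [this] at h hp
    nlinarith
  -- eventual estimate
  have hev := eventually_lt_of_lt_liminf hr
  obtain ⟨N, hN⟩ := eventually_atTop.1 hev
  have hest : ∀ n ≥ N, 0 < -Real.log (m (n + 2) * ε (n + 2)) ∧
      r * (-Real.log (m (n + 2) * ε (n + 2))) ≤ Real.log (M n) := by
    intro n hn
    have h := hN (n + 1) (by omega)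
    have e : ∏ i ∈ Finset.Icc 2 (n + 1), (m i : ℝ) = (M n : ℝ) := by simp [M]
    rw [e] at h
    have h' : (r : ℝ) < Real.log (M n) / (-Real.log (m (n + 2) * ε (n + 2))) := by
      rw [← ENNReal.ofReal_coe_nnreal] at h
      exact (ENNReal.ofReal_lt_ofReal_iff_of_nonneg r.2).1 h
    have hlog : 0 ≤ Real.log (M n) := Real.log_nonneg (by exact_mod_cast hMpos n)
    have hL : 0 < -Real.log (m (n + 2) * ε (n + 2)) := by
      by_contra hcon
      have := div_nonpos_of_nonneg_of_nonpos hlog (not_lt.1 hcon)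
      linarith
    exact ⟨hL, ((lt_div_iff₀ hL).1 h').le⟩
  have hqpos : ∀ n, 0 < (m (n + 2) : ℝ) * ε (n + 2) := fun n =>
    mul_pos (by have := hm2' n; exact_mod_cast (by omega : 0 < m (n + 2))) (hε (n + 1))
  -- r ≤ 1
  have hr1 : (r : ℝ) ≤ 1 := by
    by_contra hcon
    push Not at hcon
    have hb : ∀ n ≥ N, (n : ℝ) * Real.log 2 * (r - 1) ≤ Real.log 2 * r := by
      intro n hn
      obtain ⟨hL, h1⟩ := hest n hn
      have hMp : (0 : ℝ) < M n := by exact_mod_cast hMpos n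
      have h2 := Real.log_le_log (mul_pos hMp (hqpos n)) (hbd n)
      rw [Real.log_mul hMp.ne' (hqpos n).ne'] at h2
      have h3 : Real.log ((2 : ℝ) ^ n) ≤ Real.log (M n) :=
        Real.log_le_log (by positivity) (by exact_mod_cast hMge n)
      rw [Real.log_pow] at h3
      nlinarith
    obtain ⟨K, hK⟩ := exists_nat_gt ((r : ℝ) / (r - 1))
    have h1 := hb (max N K) (le_max_left _ _)
    have h2 : (K : ℝ) ≤ (max N K : ℕ) := by exact_mod_cast le_max_right _ _
    have h3 : (r : ℝ) < K * (r - 1) := (div_lt_iff₀ (by linarith)).1 hK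
    have h4 := Real.log_pos (by norm_num : (1 : ℝ) < 2)
    have h5 : (r : ℝ) < (max N K : ℕ) * (r - 1) := h3.trans_le (mul_le_mul_of_nonneg_right h2 (by linarith))
    nlinarith [mul_lt_mul_of_pos_left h5 h4]
  -- the coding map
  have hfl : ∀ n (t : ℝ), ⌊(M (n + 1) : ℝ) * t⌋₊ / m (n + 2) = ⌊(M n : ℝ) * t⌋₊ := by
    intro n t
    rw [← Nat.floor_div_natCast]
    congr 1
    have : (m (n + 2) : ℝ) ≠ 0 := by have := hm2' n; exact_mod_cast (by omega : m (n + 2) ≠ 0)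
    rw [hM]; push_cast
    field_simp
  have hflt : ∀ n (t : ℝ), 0 ≤ t → t < 1 → ⌊(M n : ℝ) * t⌋₊ < M n := by
    intro n t h0 h1
    have hMp : (0 : ℝ) < M n := by exact_mod_cast hMpos n
    rw [Nat.floor_lt (by positivity)]
    nlinarith
  have hg : ∀ t : ℝ, ∃ x : ℝ, 0 ≤ t → t < 1 → ∀ n,
      x ∈ Set.Icc (J n ⌊(M n : ℝ) * t⌋₊).1 (J n ⌊(M n : ℝ) * t⌋₊).2 := by
    intro t
    by_cases ht : 0 ≤ t ∧ t < 1
    · have := IsCompact.nonempty_iInter_of_sequence_nonempty_isCompact_isClosed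
        (fun n => Set.Icc (J n ⌊(M n : ℝ) * t⌋₊).1 (J n ⌊(M n : ℝ) * t⌋₊).2)
        (fun n => by
          have h := hJnest n ⌊(M (n + 1) : ℝ) * t⌋₊ (hflt _ t ht.1 ht.2)
          rwa [hfl] at h)
        (fun n => Set.nonempty_Icc.2
          (hsub (n + 1) (by omega) _ (hJmem n _ (hflt n t ht.1 ht.2))).1)
        isCompact_Icc (fun n => isClosed_Icc)
      obtain ⟨x, hx⟩ := this
      exact ⟨x, fun _ _ n => Set.mem_iInter.1 hx n⟩
    · exact ⟨0, fun h1 h2 => absurd ⟨h1, h2⟩ ht⟩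
  choose g hg using hg
  have hMNp : (0 : ℝ) < M N := by exact_mod_cast hMpos N
  have hMN1 : (1 : ℝ) / M N ≤ 1 := by
    rw [div_le_one hMNp]; exact_mod_cast hMpos N
  let D : Set ℝ := Set.Ico 0 (1 / (M N : ℝ))
  -- main estimate
  have main : ∀ t ∈ D, ∀ u ∈ D, t < u → u - t ≤ (2 * |g u - g t|) ^ (r : ℝ) := by
    intro t ht u hu htu
    have ht1 : t < 1 := ht.2.trans_le hMN1
    have hu1 : u < 1 := hu.2.trans_le hMN1
    have hNeq : ∀ t ∈ D, ⌊(M N : ℝ) * t⌋₊ = 0 := by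
      intro t ht
      rw [Nat.floor_eq_zero]
      have := (lt_div_iff₀ hMNp).1 ht.2
      linarith
    have hex : ∃ j, ⌊(M (N + j) : ℝ) * t⌋₊ ≠ ⌊(M (N + j) : ℝ) * u⌋₊ := by
      obtain ⟨K, hK⟩ := exists_nat_gt (1 / (u - t))
      refine ⟨K, fun h => ?_⟩
      have hut : 0 < u - t := by linarith
      have h1 := (div_lt_iff₀ hut).1 hK
      have h2 : (K : ℝ) ≤ M (N + K) := by
        have : K ≤ M (N + K) := (by omega : K ≤ N + K).trans
          ((Nat.lt_two_pow_self).le.trans (hMge (N + K)))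
        exact_mod_cast this
      have h3 := Nat.floor_le (a := (M (N + K) : ℝ) * t) (mul_nonneg (by positivity) ht.1)
      have h4 := Nat.lt_floor_add_one ((M (N + K) : ℝ) * u)
      rw [← h] at h4
      nlinarith
    have hj := Nat.find_spec hex
    have hjm := fun i => Nat.find_min hex (m := i)
    rcases hfe : Nat.find hex with _ | i
    · rw [hfe] at hj
      exact absurd ((hNeq t ht).trans (hNeq u hu).symm) hj
    rw [hfe] at hj hjm
    have hi := not_not.1 (hjm i (by omega))
    set n := N + i with hn
    have en : N + (i + 1) = n + 1 := by omega
    rw [en] at hj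
    have hle : ⌊(M (n + 1) : ℝ) * t⌋₊ ≤ ⌊(M (n + 1) : ℝ) * u⌋₊ := by gcongr
    obtain ⟨p, hp⟩ := Nat.exists_eq_add_of_lt (lt_of_le_of_ne hle hj)
    have hMp : (0 : ℝ) < M n := by exact_mod_cast hMpos n
    have hMp' : (0 : ℝ) < M (n + 1) := by exact_mod_cast hMpos (n + 1)
    have hd1 : u - t ≤ 1 / M n := by
      rw [le_div_iff₀ hMp]
      have h3 := Nat.floor_le (a := (M n : ℝ) * t) (mul_nonneg hMp.le ht.1)
      have h4 := Nat.lt_floor_add_one ((M n : ℝ) * u)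
      rw [← hi] at h4
      linarith
    have hs := hsep (n + 1) ⌊(M (n + 1) : ℝ) * t⌋₊ p (by rw [← hp]; exact hflt _ u hu.1 hu1)
    rw [← hp] at hs
    have hgt := (hg t ht.1 ht1 (n + 1)).2
    have hgu := (hg u hu.1 hu1 (n + 1)).1
    have hdiff : ((p + 1 : ℕ) : ℝ) * ε (n + 2) ≤ |g u - g t| := by
      refine le_trans ?_ (le_abs_self _)
      have : ε (n + 1 + 1) = ε (n + 2) := rfl
      rw [this] at hs
      linarith
    have hd2 : u - t ≤ 2 * |g u - g t| / (m (n + 2) * ε (n + 2) * M n) := by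
      rw [le_div_iff₀ (mul_pos (hqpos n) hMp)]
      have h3 := Nat.floor_le (a := (M (n + 1) : ℝ) * t) (mul_nonneg hMp'.le ht.1)
      have h4 := Nat.lt_floor_add_one ((M (n + 1) : ℝ) * u)
      rw [hp] at h4
      have e3 : (M (n + 1) : ℝ) = M n * m (n + 2) := by rw [hM]; push_cast; ring
      have h5 : (M (n + 1) : ℝ) * (u - t) ≤ 2 * ((p + 1 : ℕ) : ℝ) := by
        push_cast at h4 ⊢
        have : (0 : ℝ) ≤ p := by positivity
        linarith
      have h6 := mul_le_mul_of_nonneg_right h5 (hε (n + 1)).le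
      have e4 : ε (n + 1 + 1) = ε (n + 2) := rfl
      rw [e4] at h6
      calc (u - t) * (m (n + 2) * ε (n + 2) * M n) = M (n + 1) * (u - t) * ε (n + 2) := by
            rw [e3]; ring
        _ ≤ _ := h6
        _ ≤ _ := by linarith
    exact fal_interp (M n) (2 * |g u - g t|) (u - t) (m (n + 2) * ε (n + 2)) r hMp (hqpos n)
      hrpos hr1 (by positivity) (by linarith) hd1 hd2 (hest n (by omega)).2
  have main' : ∀ t ∈ D, ∀ u ∈ D, |t - u| ≤ (2 * |g t - g u|) ^ (r : ℝ) := by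
    intro t ht u hu
    rcases lt_trichotomy t u with h | h | h
    · rw [abs_sub_comm t u, abs_sub_comm (g t), abs_of_pos (sub_pos.2 h)]
      exact main t ht u hu h
    · rw [h, sub_self, abs_zero]; positivity
    · rw [abs_of_pos (sub_pos.2 h)]
      exact main u hu t ht h
  have hinj : Set.InjOn g D := by
    intro t ht u hu h
    have := main' t ht u hu
    rw [h, sub_self, abs_zero, mul_zero, Real.zero_rpow hrpos.ne'] at this
    exact sub_eq_zero.1 (abs_eq_zero.1 (le_antisymm this (abs_nonneg _)))
  let f := Function.invFunOn g D
  have hf : ∀ t ∈ D, f (g t) = t := fun t ht => hinj.leftInvOn_invFunOn ht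
  have hsubE : Set.image g D ⊆ E := by
    rintro _ ⟨t, ht, rfl⟩
    have ht1 : t < 1 := ht.2.trans_le hMN1
    rw [hE]
    refine Set.mem_iInter₂.2 fun n hn => ?_
    obtain ⟨n, rfl⟩ := Nat.exists_eq_add_of_le' (show 1 ≤ n from hn)
    exact Set.mem_iUnion₂.2 ⟨_, hJmem n _ (hflt n t ht.1 ht1), hg t ht.1 ht1 n⟩
  have hhol : HolderOnWith (2 ^ (r : ℝ)) r f (Set.image g D) := by
    rintro _ ⟨t, ht, rfl⟩ _ ⟨u, hu, rfl⟩
    rw [hf t ht, hf u hu, edist_dist, edist_dist, Real.dist_eq, Real.dist_eq,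
      ENNReal.ofReal_rpow_of_nonneg (abs_nonneg _) hrpos.le]
    have h := main' t ht u hu
    rw [Real.mul_rpow (by norm_num) (abs_nonneg _)] at h
    refine (ENNReal.ofReal_le_ofReal h).trans ?_
    rw [ENNReal.ofReal_mul (by positivity)]
    gcongr
    rw [ENNReal.ofReal_le_iff_le_toReal (by simp)]
    simp
  have hdim := hhol.dimH_image_le (pos_iff_ne_zero.2 hr0)
  have himg : Set.image f (Set.image g D) = D := by
    rw [Set.image_image]
    ext t
    constructor
    · rintro ⟨u, hu, rfl⟩; simp only [hf u hu]; exact hu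
    · intro ht; exact ⟨t, ht, hf t ht⟩
  have hD : dimH D = 1 := by
    have h1 : dimH D = (Module.finrank ℝ ℝ : ENNReal) := by
      apply Real.dimH_of_nonempty_interior
      rw [interior_Ico]
      exact Set.nonempty_Ioo.2 (by positivity)
    simpa using h1
  rw [himg, hD] at hdim
  have h2 := hdim.trans (ENNReal.div_le_div_right (dimH_mono hsubE) _)
  rw [ENNReal.le_div_iff_mul_le (Or.inl (by simpa using hr0)) (Or.inl (by simp)), one_mul] at h2
  exact h2
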